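/- arXiv:1005.3942 — 4 statements merged into one kernel-verified Lean document; each statement's English description precedes it below -/
import Mathlib

section
/- Let u, h, f : ℝ × ℝ → ℝ be smooth functions of (x,t) with h nowhere vanishing, and let λ ∈ ℝ. Suppose that for all (x,t) the identities h_t = λ (u h)_x and f_t = 2 λ u_x f + λ u f_x hold. Then the quotient f/h satisfies the same transport-type identity as h, namely (f/h)_t = λ (u f/h)_x everywhere. -/
/-- Partial derivative in the first (space) variable. -/
noncomputable def pdx (f : ℝ → ℝ → ℝ) : ℝ → ℝ → ℝ := fun x t => deriv (fun y => f y t) x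

/-- Partial derivative in the second (time) variable. -/
noncomputable def pdt (f : ℝ → ℝ → ℝ) : ℝ → ℝ → ℝ := fun x t => deriv (fun s => f x s) t

/-- Smoothness of a function of two real variables. -/
def Smooth2 (f : ℝ → ℝ → ℝ) : Prop := ContDiff ℝ (⊤ : ℕ∞) (fun p : ℝ × ℝ => f p.1 p.2)

theorem Smooth2.differentiableAt_fst {g : ℝ → ℝ → ℝ} (hg : Smooth2 g) (x t : ℝ) :
    DifferentiableAt ℝ (fun y => g y t) x := by
  have h : Differentiable ℝ (fun p : ℝ × ℝ => g p.1 p.2) := ContDiff.differentiable hg (by simp)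
  exact (h (x, t)).comp (f := fun y : ℝ => (y, t)) x (by fun_prop)

theorem Smooth2.differentiableAt_snd {g : ℝ → ℝ → ℝ} (hg : Smooth2 g) (x t : ℝ) :
    DifferentiableAt ℝ (fun s => g x s) t := by
  have h : Differentiable ℝ (fun p : ℝ × ℝ => g p.1 p.2) := ContDiff.differentiable hg (by simp)
  exact (h (x, t)).comp (f := fun s : ℝ => (x, s)) t (by fun_prop)

theorem Smooth2.hasDerivAt_pdx {g : ℝ → ℝ → ℝ} (hg : Smooth2 g) (x t : ℝ) :
    HasDerivAt (fun y => g y t) (pdx g x t) x :=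
  (hg.differentiableAt_fst x t).hasDerivAt

theorem Smooth2.hasDerivAt_pdt {g : ℝ → ℝ → ℝ} (hg : Smooth2 g) (x t : ℝ) :
    HasDerivAt (fun s => g x s) (pdt g x t) t :=
  (hg.differentiableAt_snd x t).hasDerivAt

/-- Proposition 1 of the paper. If `h_t = λ (u h)_x` and
`f_t = 2 λ u_x f + λ u f_x`, with `h` nowhere vanishing, then
`(f/h)_t = λ (u f/h)_x` everywhere. -/
theorem statement0 (u h f : ℝ → ℝ → ℝ) (lam : ℝ)
    (hu : Smooth2 u) (hh : Smooth2 h) (hf : Smooth2 f)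
    (hne : ∀ x t, h x t ≠ 0)
    (hEq : ∀ x t, pdt h x t = lam * pdx (fun x t => u x t * h x t) x t)
    (fEq : ∀ x t, pdt f x t = 2 * lam * pdx u x t * f x t + lam * u x t * pdx f x t) :
    ∀ x t, pdt (fun x t => f x t / h x t) x t
      = lam * pdx (fun x t => u x t * f x t / h x t) x t := by
  intro x t
  have h0 := hne x t
  have huh : pdx (fun x t => u x t * h x t) x t = pdx u x t * h x t + u x t * pdx h x t :=
    ((hu.hasDerivAt_pdx x t).mul (hh.hasDerivAt_pdx x t)).deriv
  have hl : pdt (fun x t => f x t / h x t) x t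
      = (pdt f x t * h x t - f x t * pdt h x t) / h x t ^ 2 :=
    ((hf.hasDerivAt_pdt x t).div (hh.hasDerivAt_pdt x t) h0).deriv
  have hr : pdx (fun x t => u x t * f x t / h x t) x t
      = ((pdx u x t * f x t + u x t * pdx f x t) * h x t - u x t * f x t * pdx h x t)
        / h x t ^ 2 :=
    (((hu.hasDerivAt_pdx x t).mul (hf.hasDerivAt_pdx x t)).div (hh.hasDerivAt_pdx x t) h0).deriv
  rw [hl, hr, hEq, huh, fEq]
  ring
end

section
/- Let k be a nonzero real number and let u, h : ℝ × ℝ → ℝ be smooth functions, 2π-periodic in the space variable x, with h everywhere strictly positive, satisfying the relationship h_t = k u_x h + u h_x for all (x,t). Then the functional H(t) = ∫₀^{2π} h(x,t)^{1/k} dx is constant in t. -/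
theorem hasDerivAt_slice_fst {f : ℝ × ℝ → ℝ} {x t : ℝ} (hf : DifferentiableAt ℝ f (x, t)) :
    HasDerivAt (fun y => f (y, t)) (fderiv ℝ f (x, t) (1, 0)) x :=
  hf.hasFDerivAt.comp_hasDerivAt x ((hasDerivAt_id x).prodMk (hasDerivAt_const x t))

theorem hasDerivAt_slice_snd {f : ℝ × ℝ → ℝ} {x t : ℝ} (hf : DifferentiableAt ℝ f (x, t)) :
    HasDerivAt (fun s => f (x, s)) (fderiv ℝ f (x, t) (0, 1)) t :=
  hf.hasFDerivAt.comp_hasDerivAt t ((hasDerivAt_const t x).prodMk (hasDerivAt_id t))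

/-- A density `ρ` whose time derivative is the space derivative of a flux `q` with equal values at
the two endpoints has a conserved integral. -/
theorem integral_eq_of_conservation_law {ρ q : ℝ × ℝ → ℝ} (hρ : Differentiable ℝ ρ)
    (hq : Differentiable ℝ q) {a b : ℝ} (hab : ∀ t, q (b, t) = q (a, t))
    (hlaw : ∀ p, fderiv ℝ ρ p (0, 1) = fderiv ℝ q p (1, 0)) (t₁ t₂ : ℝ) :
    ∫ x in a..b, ρ (x, t₁) = ∫ x in a..b, ρ (x, t₂) := by
  have key := MeasureTheory.integral2_divergence_prod_of_hasFDerivAt (fun p => -q p) ρ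
    (fun p => -fderiv ℝ q p) (fderiv ℝ ρ) a t₁ b t₂ hq.continuous.neg.continuousOn
    hρ.continuous.continuousOn (fun p _ => (hq p).hasFDerivAt.neg)
    (fun p _ => (hρ p).hasFDerivAt) (by simp [hlaw])
  simp only [neg_apply, hlaw, neg_add_cancel,
    intervalIntegral.integral_zero, hab] at key
  linarith

/-- Proposition 2 of the paper. If `h_t = k u_x h + u h_x` with `h > 0`
and `u, h` are `2π`-periodic in `x`, then `H(t) = ∫₀^{2π} h^{1/k} dx` is conserved. -/
theorem statement1 (k : ℝ) (hk : k ≠ 0) (u h : ℝ → ℝ → ℝ)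
    (hu : Smooth2 u) (hh : Smooth2 h)
    (huper : ∀ t, Function.Periodic (fun x => u x t) (2 * Real.pi))
    (hhper : ∀ t, Function.Periodic (fun x => h x t) (2 * Real.pi))
    (hpos : ∀ x t, 0 < h x t)
    (hEq : ∀ x t, pdt h x t = k * pdx u x t * h x t + u x t * pdx h x t) :
    ∀ t₁ t₂ : ℝ, (∫ x in (0:ℝ)..(2 * Real.pi), h x t₁ ^ (1 / k))
      = ∫ x in (0:ℝ)..(2 * Real.pi), h x t₂ ^ (1 / k) := by
  have hU : Differentiable ℝ (fun p : ℝ × ℝ => u p.1 p.2) := hu.differentiable (by simp)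
  have hH : Differentiable ℝ (fun p : ℝ × ℝ => h p.1 p.2) := hh.differentiable (by simp)
  have hρ : Differentiable ℝ (fun p : ℝ × ℝ => h p.1 p.2 ^ (1 / k)) :=
    hH.rpow_const fun p => Or.inl (hpos p.1 p.2).ne'
  refine integral_eq_of_conservation_law hρ (hU.mul hρ) (fun t => ?_) ?_
  · have hu₀ := huper t 0
    have hh₀ := hhper t 0
    simp only [zero_add] at hu₀ hh₀
    simp [hu₀, hh₀]
  · rintro ⟨x, t⟩
    have hux : HasDerivAt (fun y => u y t) (pdx u x t) x :=
      (hasDerivAt_slice_fst (hU (x, t))).differentiableAt.hasDerivAt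
    have hhx : HasDerivAt (fun y => h y t) (pdx h x t) x :=
      (hasDerivAt_slice_fst (hH (x, t))).differentiableAt.hasDerivAt
    have hht : HasDerivAt (fun s => h x s) (pdt h x t) t :=
      (hasDerivAt_slice_snd (hH (x, t))).differentiableAt.hasDerivAt
    have hne : h x t ≠ 0 := (hpos x t).ne'
    rw [(hasDerivAt_slice_snd (hρ (x, t))).unique (hht.rpow_const (Or.inl hne)),
      (hasDerivAt_slice_fst ((hU.mul hρ) (x, t))).unique
        (hux.mul (hhx.rpow_const (Or.inl hne))), hEq, Real.rpow_sub_one hne]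
    field_simp
end

section
/- Let u, v : ℝ × ℝ → ℝ be smooth functions satisfying u_t = v - u u_x, v_t = -u v_x, and let λ ∈ ℝ. Define the 2×2 matrix-valued functions ℓ = [[-λ u_x, -v_x], [2λ², λ u_x]], q = [[0,0],[-λ,0]], and p = -u·ℓ + q. Then the zero-curvature (Lax compatibility) condition ∂_t ℓ - ∂_x p + ℓ p - p ℓ = 0 holds identically, entrywise, at every point (x,t). -/
/-- The spatial Lax matrix `ℓ[u,v;λ]` for the `N = 2` Riemann type system. -/
noncomputable def laxL2 (u v : ℝ → ℝ → ℝ) (lam : ℝ) (x t : ℝ) : Matrix (Fin 2) (Fin 2) ℝ :=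
  !![-lam * pdx u x t, -pdx v x t; 2 * lam ^ 2, lam * pdx u x t]

/-- The constant matrix `q(λ)` for the `N = 2` Riemann type system. -/
noncomputable def laxQ2 (lam : ℝ) : Matrix (Fin 2) (Fin 2) ℝ := !![0, 0; -lam, 0]

/-- The temporal Lax matrix `p(ℓ) = -u ℓ + q(λ)`. -/
noncomputable def laxP2 (u v : ℝ → ℝ → ℝ) (lam : ℝ) (x t : ℝ) : Matrix (Fin 2) (Fin 2) ℝ :=
  (-(u x t)) • laxL2 u v lam x t + laxQ2 lam

namespace Smooth2

variable {f : ℝ → ℝ → ℝ}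

lemma differentiable (hf : Smooth2 f) : Differentiable ℝ (fun p : ℝ × ℝ => f p.1 p.2) :=
  ContDiff.differentiable hf (by simp)

lemma hasDerivAt_fst (hf : Smooth2 f) (x t : ℝ) :
    HasDerivAt (fun y => f y t) (fderiv ℝ (fun p : ℝ × ℝ => f p.1 p.2) (x, t) (1, 0)) x :=
  (hf.differentiable (x, t)).hasFDerivAt.comp_hasDerivAt (f := fun y => (y, t)) x
    ((hasDerivAt_id' x).prodMk (hasDerivAt_const x t))

lemma hasDerivAt_snd (hf : Smooth2 f) (x t : ℝ) :
    HasDerivAt (fun s => f x s) (fderiv ℝ (fun p : ℝ × ℝ => f p.1 p.2) (x, t) (0, 1)) t :=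
  (hf.differentiable (x, t)).hasFDerivAt.comp_hasDerivAt (f := fun s => (x, s)) t
    ((hasDerivAt_const t x).prodMk (hasDerivAt_id' t))

lemma pdx_eq (hf : Smooth2 f) (x t : ℝ) :
    pdx f x t = fderiv ℝ (fun p : ℝ × ℝ => f p.1 p.2) (x, t) (1, 0) :=
  (hf.hasDerivAt_fst x t).deriv

lemma pdt_eq (hf : Smooth2 f) (x t : ℝ) :
    pdt f x t = fderiv ℝ (fun p : ℝ × ℝ => f p.1 p.2) (x, t) (0, 1) :=
  (hf.hasDerivAt_snd x t).deriv

lemma hasDerivAt_pdx_s11 (hf : Smooth2 f) (x t : ℝ) :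
    HasDerivAt (fun y => f y t) (pdx f x t) x :=
  hf.pdx_eq x t ▸ hf.hasDerivAt_fst x t

lemma hasDerivAt_pdt_s11 (hf : Smooth2 f) (x t : ℝ) :
    HasDerivAt (fun s => f x s) (pdt f x t) t :=
  hf.pdt_eq x t ▸ hf.hasDerivAt_snd x t

lemma contDiff_fderiv (hf : Smooth2 f) :
    ContDiff ℝ (⊤ : ℕ∞) (fderiv ℝ (fun p : ℝ × ℝ => f p.1 p.2)) :=
  ContDiff.fderiv_right hf (by simp)

protected lemma pdx (hf : Smooth2 f) : Smooth2 (pdx f) := by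
  simpa only [Smooth2, hf.pdx_eq] using hf.contDiff_fderiv.clm_apply contDiff_const

protected lemma pdt (hf : Smooth2 f) : Smooth2 (pdt f) := by
  simpa only [Smooth2, hf.pdt_eq] using hf.contDiff_fderiv.clm_apply contDiff_const

lemma pdt_pdx (hf : Smooth2 f) (x t : ℝ) : pdt (pdx f) x t = pdx (pdt f) x t := by
  have hd : DifferentiableAt ℝ (fderiv ℝ (fun p : ℝ × ℝ => f p.1 p.2)) (x, t) :=
    hf.contDiff_fderiv.differentiable (by simp) (x, t)
  have hsymm : IsSymmSndFDerivAt ℝ (fun p : ℝ × ℝ => f p.1 p.2) (x, t) :=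
    ContDiffAt.isSymmSndFDerivAt (n := (⊤ : ℕ∞)) (ContDiff.contDiffAt hf)
      (by simp only [minSmoothness_of_isRCLikeNormedField]; exact WithTop.coe_le_coe.2 (le_top (a := (2 : ℕ∞))))
  rw [hf.pdx.pdt_eq, hf.pdt.pdx_eq]
  simp only [hf.pdx_eq, hf.pdt_eq, Prod.mk.eta]
  rw [fderiv_clm_apply hd (differentiableAt_const _),
    fderiv_clm_apply hd (differentiableAt_const _)]
  simpa using hsymm.eq (0, 1) (1, 0)

end Smooth2

/-- the zero-curvature (Lax compatibility) condition
`∂_t ℓ - ∂_x p + ℓ p - p ℓ = 0` holds entrywise for the `N = 2`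
Riemann type system `u_t = v - u u_x`, `v_t = -u v_x`. -/
theorem statement11 (u v : ℝ → ℝ → ℝ) (lam : ℝ)
    (hu : Smooth2 u) (hv : Smooth2 v)
    (sys1 : ∀ x t, pdt u x t = v x t - u x t * pdx u x t)
    (sys2 : ∀ x t, pdt v x t = -(u x t) * pdx v x t) :
    ∀ (x t : ℝ) (i j : Fin 2),
      deriv (fun s => laxL2 u v lam x s i j) t
        - deriv (fun y => laxP2 u v lam y t i j) x
        + ((laxL2 u v lam x t * laxP2 u v lam x t) i j
            - (laxP2 u v lam x t * laxL2 u v lam x t) i j) = 0 := by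
  intro x t i j
  have hux := hu.hasDerivAt_pdx_s11 x t
  have huxx := hu.pdx.hasDerivAt_pdx_s11 x t
  have hvxx := hv.pdx.hasDerivAt_pdx_s11 x t
  have huxt := hu.pdx.hasDerivAt_pdt_s11 x t
  have hvxt := hv.pdx.hasDerivAt_pdt_s11 x t
  have hu_mixed : pdt (pdx u) x t
      = pdx v x t - (pdx u x t * pdx u x t + u x t * pdx (pdx u) x t) := by
    rw [hu.pdt_pdx]
    simp only [funext₂ sys1]
    exact ((hv.hasDerivAt_pdx_s11 x t).sub (hux.mul huxx)).deriv
  have hv_mixed : pdt (pdx v) x t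
      = -pdx u x t * pdx v x t + -(u x t) * pdx (pdx v) x t := by
    rw [hv.pdt_pdx]
    simp only [funext₂ sys2]
    exact (hux.neg.mul hvxx).deriv
  rw [hu_mixed] at huxt
  rw [hv_mixed] at hvxt
  fin_cases i <;> fin_cases j <;>
    simp only [laxP2, laxL2, laxQ2, Matrix.mul_apply, Fin.sum_univ_two, Matrix.add_apply,
      Matrix.smul_apply, smul_eq_mul, Matrix.of_apply, Matrix.cons_val', Matrix.cons_val_zero,
      Matrix.cons_val_one, Matrix.cons_val_fin_one, Fin.zero_eta, Fin.mk_one, Fin.isValue]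
  · rw [(huxt.const_mul (-lam)).deriv,
      ((hux.fun_neg.fun_mul (huxx.const_mul (-lam))).add_const 0).deriv]
    ring
  · rw [hvxt.fun_neg.deriv, ((hux.fun_neg.fun_mul hvxx.fun_neg).add_const 0).deriv]
    ring
  · rw [deriv_const, ((hux.fun_neg.mul_const (2 * lam ^ 2)).add_const (-lam)).deriv]
    ring
  · rw [(huxt.const_mul lam).deriv,
      ((hux.fun_neg.fun_mul (huxx.const_mul lam)).add_const 0).deriv]
    ring
end

section
/- Let a, b : ℝ → ℝ be smooth functions (thought of as u_x and v_x at a fixed time), let λ be a nonzero real number, and let f₁, f₂ : ℝ → ℝ be smooth functions with f₂ nowhere vanishing, satisfying the linear system f₁' = -λ a f₁ - b f₂ and f₂' = 2λ² f₁ + λ a f₂. Then the logarithmic derivative σ = f₂'/f₂ satisfies the Riccati-type functional equation (σ - λ a)' + σ² + λ² (2 b - a²) = 0. -/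
/-- the Riccati-type generating functional equation. If
`f₁' = -λ a f₁ - b f₂` and `f₂' = 2λ² f₁ + λ a f₂` with `f₂` nowhere vanishing,
then `σ = f₂'/f₂` satisfies `(σ - λ a)' + σ² + λ²(2b - a²) = 0`. -/
theorem statement13 (a b f₁ f₂ : ℝ → ℝ) (lam : ℝ) (hlam : lam ≠ 0)
    (ha : ContDiff ℝ (⊤ : ℕ∞) a) (hb : ContDiff ℝ (⊤ : ℕ∞) b)
    (hf1 : ContDiff ℝ (⊤ : ℕ∞) f₁) (hf2 : ContDiff ℝ (⊤ : ℕ∞) f₂)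
    (hne : ∀ x, f₂ x ≠ 0)
    (ode1 : ∀ x, deriv f₁ x = -lam * a x * f₁ x - b x * f₂ x)
    (ode2 : ∀ x, deriv f₂ x = 2 * lam ^ 2 * f₁ x + lam * a x * f₂ x) :
    ∀ x, deriv (fun y => deriv f₂ y / f₂ y - lam * a y) x
      + (deriv f₂ x / f₂ x) ^ 2 + lam ^ 2 * (2 * b x - (a x) ^ 2) = 0 := by
  intro x
  have hσ : (fun y => deriv f₂ y / f₂ y - lam * a y) =
      fun y => 2 * lam ^ 2 * (f₁ / f₂) y := by
    funext y
    have hy := hne y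
    rw [ode2, Pi.div_apply]
    field_simp
    ring
  have h1 : HasDerivAt f₁ (deriv f₁ x) x :=
    ((hf1.differentiable (by simp)) x).hasDerivAt
  have h2 : HasDerivAt f₂ (deriv f₂ x) x :=
    ((hf2.differentiable (by simp)) x).hasDerivAt
  have hx := hne x
  rw [hσ, ((h1.div h2 hx).const_mul (2 * lam ^ 2)).deriv, ode1, ode2]
  field_simp
  ring
end
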